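/- In an arbitrage-free discrete market model with proportional transaction costs, for an American option with adapted ℝ²-valued payoff (ξ,ζ), the seller's price equals the value at 0 of the function z_0 produced by the seller's pricing recursion: π^a(ξ,ζ) = z_0(0). -/

import Mathlib

open MeasureTheory
open scoped Pointwise

noncomputable section

namespace RZ

variable {Ω : Type*} [Fintype Ω]

/-- `ω` and `ω'` lie in the same atom of the σ-field `m`. -/
def sameAtom (m : MeasurableSpace Ω) (ω ω' : Ω) : Prop :=
  ∀ A : Set Ω, MeasurableSet[m] A → (ω ∈ A ↔ ω' ∈ A)

/-- Elementary conditional expectation w.r.t. a σ-field on a finite space: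
at `ω` it is the `P`-average of `f` over the atom of `ω`. -/
def condExp (m : MeasurableSpace Ω) (P : Ω → ℝ) (f : Ω → ℝ) (ω : Ω) : ℝ :=
  (∑ ω' : Ω, Set.indicator {ω'' | sameAtom m ω ω''} (fun ω'' => P ω'' * f ω'') ω') /
  (∑ ω' : Ω, Set.indicator {ω'' | sameAtom m ω ω''} P ω')

/-- Expectation under `P`. -/
def expect (P : Ω → ℝ) (f : Ω → ℝ) : ℝ := ∑ ω : Ω, P ω * f ω

/-- Discrete market model with proportional transaction costs. -/
structure Market (Ω : Type*) [Fintype Ω] where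
  T : ℕ
  T_pos : 0 < T
  F : ℕ → MeasurableSpace Ω
  F_mono : ∀ ⦃s t : ℕ⦄, s ≤ t → F s ≤ F t
  F_zero : F 0 = ⊥
  F_top : F T = ⊤
  Q : Ω → ℝ
  Q_pos : ∀ ω, 0 < Q ω
  Q_sum : ∑ ω, Q ω = 1
  Sb : ℕ → Ω → ℝ
  Sa : ℕ → Ω → ℝ
  Sb_pos : ∀ t ω, t ≤ T → 0 < Sb t ω
  Sb_le_Sa : ∀ t ω, t ≤ T → Sb t ω ≤ Sa t ω
  Sb_adapted : ∀ t, t ≤ T → Measurable[F t] (Sb t)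
  Sa_adapted : ∀ t, t ≤ T → Measurable[F t] (Sa t)

variable (M : Market Ω)

/-- Liquidation value θ_t(γ, δ) in scenario ω, for a cash position γ and stock position δ. -/
def liq (t : ℕ) (ω : Ω) (γ δ : ℝ) : ℝ :=
  γ + M.Sb t ω * max δ 0 - M.Sa t ω * max (-δ) 0

/-- An adapted (real-valued) process. -/
def IsAdapted (X : ℕ → Ω → ℝ) : Prop := ∀ t, t ≤ M.T → Measurable[M.F t] (X t)

/-- An adapted ℝ²-valued payoff process. -/
def AdaptedPair (ξ ζ : ℕ → Ω → ℝ) : Prop := IsAdapted M ξ ∧ IsAdapted M ζ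

/-- Self-financing strategy. -/
def SelfFinancing (α β : ℕ → Ω → ℝ) : Prop :=
  Measurable[M.F 0] (α 0) ∧ Measurable[M.F 0] (β 0) ∧
  (∀ t, t < M.T → Measurable[M.F t] (α (t + 1)) ∧ Measurable[M.F t] (β (t + 1))) ∧
  (∀ t, t < M.T → ∀ ω, 0 ≤ liq M t ω (α t ω - α (t + 1) ω) (β t ω - β (t + 1) ω))

/-- Pure stopping time with values in {0,...,T}. -/
def IsStop (τ : Ω → ℕ) : Prop :=
  (∀ ω, τ ω ≤ M.T) ∧ ∀ t : ℕ, MeasurableSet[M.F t] {ω | τ ω = t}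

/-- Seller superhedging strategy. -/
def SellerHedge (ξ ζ α β : ℕ → Ω → ℝ) : Prop :=
  SelfFinancing M α β ∧
  ∀ τ, IsStop M τ → ∀ ω,
    0 ≤ liq M (τ ω) ω (α (τ ω) ω - ξ (τ ω) ω) (β (τ ω) ω - ζ (τ ω) ω)

/-- Buyer superhedging strategy. -/
def BuyerHedge (ξ ζ α β : ℕ → Ω → ℝ) : Prop :=
  SelfFinancing M α β ∧
  ∃ τ, IsStop M τ ∧ ∀ ω,
    0 ≤ liq M (τ ω) ω (α (τ ω) ω + ξ (τ ω) ω) (β (τ ω) ω + ζ (τ ω) ω)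

/-- Seller's (ask) price: infimum of the initial costs of seller superhedging strategies. -/
def askPrice (ξ ζ : ℕ → Ω → ℝ) : ℝ :=
  sInf {x | ∃ α β, SellerHedge M ξ ζ α β ∧ ∀ ω, x = -liq M 0 ω (-α 0 ω) (-β 0 ω)}

/-- Buyer's (bid) price: supremum of the amounts raised by buyer superhedging strategies. -/
def bidPrice (ξ ζ : ℕ → Ω → ℝ) : ℝ :=
  sSup {x | ∃ α β, BuyerHedge M ξ ζ α β ∧ ∀ ω, x = liq M 0 ω (-α 0 ω) (-β 0 ω)}

/-- Mixed stopping time. -/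
def IsMixedStop (χ : ℕ → Ω → ℝ) : Prop :=
  (∀ t, t ≤ M.T → Measurable[M.F t] (χ t)) ∧ (∀ t ω, 0 ≤ χ t ω) ∧
  ∀ ω, ∑ t ∈ Finset.range (M.T + 1), χ t ω = 1

/-- χ*_t = Σ_{s=t}^T χ_s  (so χ*_{T+1} = 0). -/
def chiStar (χ : ℕ → Ω → ℝ) (t : ℕ) (ω : Ω) : ℝ := ∑ s ∈ Finset.Icc t M.T, χ s ω

/-- Z^{χ*}_t = Σ_{s=t}^T χ_s Z_s  (so Z^{χ*}_{T+1} = 0). -/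
def starVal (χ Z : ℕ → Ω → ℝ) (t : ℕ) (ω : Ω) : ℝ :=
  ∑ s ∈ Finset.Icc t M.T, χ s ω * Z s ω

/-- Z_χ = Σ_{t=0}^T χ_t Z_t. -/
def mixVal (χ Z : ℕ → Ω → ℝ) (ω : Ω) : ℝ :=
  ∑ t ∈ Finset.range (M.T + 1), χ t ω * Z t ω

/-- Membership in the family barP(χ). -/
def memBarP (χ : ℕ → Ω → ℝ) (P : Ω → ℝ) (S : ℕ → Ω → ℝ) : Prop :=
  (∀ ω, 0 ≤ P ω) ∧ (∑ ω, P ω) = 1 ∧ IsAdapted M S ∧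
  (∀ t ω, t ≤ M.T → M.Sb t ω ≤ S t ω ∧ S t ω ≤ M.Sa t ω) ∧
  (∀ t, t ≤ M.T → ∀ ω, 0 < P ω →
    chiStar M χ (t + 1) ω * M.Sb t ω ≤ condExp (M.F t) P (starVal M χ S (t + 1)) ω ∧
    condExp (M.F t) P (starVal M χ S (t + 1)) ω ≤ chiStar M χ (t + 1) ω * M.Sa t ω)

/-- Membership in the family P(χ): barP(χ) with P equivalent to Q. -/
def memP (χ : ℕ → Ω → ℝ) (P : Ω → ℝ) (S : ℕ → Ω → ℝ) : Prop :=
  memBarP M χ P S ∧ ∀ ω, 0 < P ω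

/-- The mixed stopping time χ^τ associated with a pure stopping time τ. -/
def pureChi (τ : Ω → ℕ) : ℕ → Ω → ℝ := fun t ω => if τ ω = t then 1 else 0

/-- Arbitrage-free: there is an equivalent probability measure and a martingale
between the bid and ask prices. -/
def ArbitrageFree : Prop :=
  ∃ (P : Ω → ℝ) (S : ℕ → Ω → ℝ),
    (∀ ω, 0 < P ω) ∧ (∑ ω, P ω) = 1 ∧ IsAdapted M S ∧
    (∀ t ω, t ≤ M.T → M.Sb t ω ≤ S t ω ∧ S t ω ≤ M.Sa t ω) ∧
    (∀ t, t < M.T → ∀ ω, 0 < P ω → condExp (M.F t) P (S (t + 1)) ω = S t ω)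

/-- Epigraph of a function ℝ → ℝ, as a subset of ℝ² (first coordinate dominates). -/
def epi (f : ℝ → ℝ) : Set (ℝ × ℝ) := {p | f p.2 ≤ p.1}

/-- The function h_{[b,a]}(y) = a y⁻ − b y⁺. -/
def hfun (b a : ℝ) (y : ℝ) : ℝ := a * max (-y) 0 - b * max y 0

/-- Seller's payoff function u_t(y) = ξ_t + (y − ζ_t)⁻ S^a_t − (y − ζ_t)⁺ S^b_t. -/
def uSell (ξ ζ : ℕ → Ω → ℝ) (t : ℕ) (ω : Ω) (y : ℝ) : ℝ :=
  ξ t ω + M.Sa t ω * max (ζ t ω - y) 0 - M.Sb t ω * max (y - ζ t ω) 0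

/-- Buyer's payoff function u_t(y) = −ξ_t + (y + ζ_t)⁻ S^a_t − (y + ζ_t)⁺ S^b_t. -/
def uBuy (ξ ζ : ℕ → Ω → ℝ) (t : ℕ) (ω : Ω) (y : ℝ) : ℝ :=
  -ξ t ω + M.Sa t ω * max (-(y + ζ t ω)) 0 - M.Sb t ω * max (y + ζ t ω) 0

/-- The seller's pricing recursion: one function per atom,
`z_T = u_T` and `epi z_{t-1} = epi u_{t-1} ∩ (epi h + ⋂_{succ} epi z_t)`. -/
def SellerRec (ξ ζ : ℕ → Ω → ℝ) (z : ℕ → Ω → ℝ → ℝ) : Prop :=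
  (∀ t ω ω', t ≤ M.T → sameAtom (M.F t) ω ω' → z t ω = z t ω') ∧
  (∀ ω, z M.T ω = uSell M ξ ζ M.T ω) ∧
  (∀ t ω, t < M.T →
    epi (z t ω) = epi (uSell M ξ ζ t ω) ∩
      (epi (hfun (M.Sb t ω) (M.Sa t ω)) +
        ⋂ ω' ∈ {ω'' | sameAtom (M.F t) ω ω''}, epi (z (t + 1) ω')))

/-- The buyer's pricing recursion: one function per atom,
`z_T = u_T` and `epi z_{t-1} = epi u_{t-1} ∪ (epi h + ⋂_{succ} epi z_t)`. -/
def BuyerRec (ξ ζ : ℕ → Ω → ℝ) (z : ℕ → Ω → ℝ → ℝ) : Prop :=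
  (∀ t ω ω', t ≤ M.T → sameAtom (M.F t) ω ω' → z t ω = z t ω') ∧
  (∀ ω, z M.T ω = uBuy M ξ ζ M.T ω) ∧
  (∀ t ω, t < M.T →
    epi (z t ω) = epi (uBuy M ξ ζ t ω) ∪
      (epi (hfun (M.Sb t ω) (M.Sa t ω)) +
        ⋂ ω' ∈ {ω'' | sameAtom (M.F t) ω ω''}, epi (z (t + 1) ω')))

theorem sameAtom.symm {Λ : Type*} {m : MeasurableSpace Λ} {ω ω' : Λ} (h : sameAtom m ω ω') :
    sameAtom m ω' ω := fun A hA => (h A hA).symm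

theorem sameAtom.trans {Λ : Type*} {m : MeasurableSpace Λ} {ω ω' ω'' : Λ} (h : sameAtom m ω ω')
    (h' : sameAtom m ω' ω'') : sameAtom m ω ω'' := fun A hA => (h A hA).trans (h' A hA)

theorem sameAtom.mono {Λ : Type*} {m m' : MeasurableSpace Λ} (hm : m ≤ m') {ω ω' : Λ}
    (h : sameAtom m' ω ω') : sameAtom m ω ω' := fun A hA => h A (hm A hA)

theorem sameAtom.setOf_eq {Λ : Type*} {m : MeasurableSpace Λ} {ω ω' : Λ} (h : sameAtom m ω ω') :
    {ω'' | sameAtom m ω ω''} = {ω'' | sameAtom m ω' ω''} :=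
  Set.ext fun _ => ⟨h.symm.trans, h.trans⟩

theorem sameAtom.eq_of_measurable {Λ : Type*} {m : MeasurableSpace Λ} {ω ω' : Λ} (h : sameAtom m ω ω')
    {f : Λ → ℝ} (hf : Measurable[m] f) : f ω = f ω' :=
  ((h (f ⁻¹' {f ω}) (hf (measurableSet_singleton _))).1 rfl).symm

theorem measurableSet_setOf_sameAtom (m : MeasurableSpace Ω) (ω : Ω) :
    MeasurableSet[m] {ω' | sameAtom m ω ω'} := by
  have hEq : {ω' | sameAtom m ω ω'} =
      ⋂ A ∈ {A : Set Ω | MeasurableSet[m] A ∧ ω ∈ A}, A := by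
    ext ω'
    simp only [Set.mem_ofPred_eq, Set.mem_iInter]
    refine ⟨fun h A hA => (h A hA.1).1 hA.2, fun h A hA => ⟨fun hω => h A ⟨hA, hω⟩, ?_⟩⟩
    intro hω'
    by_contra hω
    exact h Aᶜ ⟨hA.compl, hω⟩ hω'
  rw [hEq]
  exact MeasurableSet.biInter (Set.to_countable _) fun A hA => hA.1

/-- On a finite space, a function which is constant on the atoms is measurable. -/
theorem measurable_of_const_on_atoms {m : MeasurableSpace Ω} {f : Ω → ℝ}
    (hf : ∀ ω ω', sameAtom m ω ω' → f ω = f ω') : Measurable[m] f := by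
  intro B _
  have hEq : f ⁻¹' B = ⋃ ω ∈ f ⁻¹' B, {ω' | sameAtom m ω ω'} := by
    ext ω'
    simp only [Set.mem_iUnion, Set.mem_ofPred_eq, exists_prop]
    refine ⟨fun h => ⟨ω', h, fun _ _ => Iff.rfl⟩, ?_⟩
    rintro ⟨ω, hω, h⟩
    simpa only [Set.mem_preimage, hf ω ω' h] using hω
  rw [hEq]
  exact MeasurableSet.biUnion (Set.to_countable _) fun ω _ => measurableSet_setOf_sameAtom m ω

theorem liq_eq_add_min {t : ℕ} (ht : t ≤ M.T) (ω : Ω) (γ δ : ℝ) :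
    liq M t ω γ δ = γ + min (M.Sb t ω * δ) (M.Sa t ω * δ) := by
  have h := M.Sb_le_Sa t ω ht
  unfold liq
  rcases le_total 0 δ with hδ | hδ
  · rw [max_eq_left hδ, max_eq_right (neg_nonpos.2 hδ),
      min_eq_left (mul_le_mul_of_nonneg_right h hδ)]
    ring
  · rw [max_eq_right hδ, max_eq_left (neg_nonneg.2 hδ),
      min_eq_right (mul_le_mul_of_nonpos_right h hδ)]
    ring

theorem liq_nonneg_add {t : ℕ} (ht : t ≤ M.T) {ω : Ω} {γ δ γ' δ' : ℝ}
    (h : 0 ≤ liq M t ω γ δ) (h' : 0 ≤ liq M t ω γ' δ') :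
    0 ≤ liq M t ω (γ + γ') (δ + δ') := by
  rw [liq_eq_add_min M ht, ← min_add_add_left, le_min_iff] at *
  constructor <;> linarith [h.1, h.2, h'.1, h'.2]

theorem mem_epi_hfun_iff (t : ℕ) (ω : Ω) (p : ℝ × ℝ) :
    p ∈ epi (hfun (M.Sb t ω) (M.Sa t ω)) ↔ 0 ≤ liq M t ω p.1 p.2 := by
  simp only [epi, hfun, liq, Set.mem_ofPred_eq]
  constructor <;> intro h <;> linarith

theorem mem_epi_uSell_iff (ξ ζ : ℕ → Ω → ℝ) (t : ℕ) (ω : Ω) (p : ℝ × ℝ) :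
    p ∈ epi (uSell M ξ ζ t ω) ↔ 0 ≤ liq M t ω (p.1 - ξ t ω) (p.2 - ζ t ω) := by
  simp only [epi, uSell, liq, Set.mem_ofPred_eq, neg_sub]
  constructor <;> intro h <;> linarith

theorem isStop_const {t : ℕ} (ht : t ≤ M.T) : IsStop M fun _ => t :=
  ⟨fun _ => ht, fun s => by by_cases h : t = s <;> simp [h]⟩

/-- A seller superhedging strategy stays in the epigraphs of the pricing recursion. -/
theorem SellerHedge.mem_epi {M : Market Ω} {ξ ζ α β : ℕ → Ω → ℝ} (h : SellerHedge M ξ ζ α β)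
    {z : ℕ → Ω → ℝ → ℝ} (hz : SellerRec M ξ ζ z) {t : ℕ} (ht : t ≤ M.T) :
    ∀ ω, (α t ω, β t ω) ∈ epi (z t ω) := by
  have hu : ∀ s, s ≤ M.T → ∀ ω, (α s ω, β s ω) ∈ epi (uSell M ξ ζ s ω) := fun s hs ω =>
    (mem_epi_uSell_iff M ξ ζ s ω _).2 (h.2 _ (isStop_const M hs) ω)
  induction ht using Nat.decreasingInduction with
  | self => exact fun ω => hz.2.1 ω ▸ hu _ le_rfl ω
  | of_succ t ht ih =>
    intro ω
    rw [hz.2.2 t ω ht]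
    refine ⟨hu t ht.le ω, Set.mem_add.2
      ⟨(α t ω - α (t + 1) ω, β t ω - β (t + 1) ω),
        (mem_epi_hfun_iff M t ω _).2 (h.1.2.2.2 t ht ω),
        (α (t + 1) ω, β (t + 1) ω), ?_, by simp⟩⟩
    refine Set.mem_iInter₂.2 fun ω' hω' => ?_
    rw [sameAtom.eq_of_measurable hω' (h.1.2.2.1 t ht).1,
      sameAtom.eq_of_measurable hω' (h.1.2.2.1 t ht).2]
    exact ih ω'

/-- The epigraphs of the pricing recursion are stable under adding solvent positions. -/
theorem SellerRec.add_mem_epi {M : Market Ω} {ξ ζ : ℕ → Ω → ℝ} {z : ℕ → Ω → ℝ → ℝ}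
    (hz : SellerRec M ξ ζ z) {t : ℕ} (ht : t < M.T) {ω : Ω} {p q : ℝ × ℝ}
    (hp : 0 ≤ liq M t ω p.1 p.2) (hq : q ∈ epi (z t ω)) : p + q ∈ epi (z t ω) := by
  rw [hz.2.2 t ω ht] at hq ⊢
  obtain ⟨hqu, hqs⟩ := hq
  obtain ⟨r, hr, s, hs, rfl⟩ := Set.mem_add.1 hqs
  rw [mem_epi_uSell_iff] at hqu
  rw [mem_epi_hfun_iff] at hr
  refine ⟨(mem_epi_uSell_iff M ξ ζ t ω _).2 ?_, Set.mem_add.2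
    ⟨p + r, (mem_epi_hfun_iff M t ω _).2 (liq_nonneg_add M ht.le hp hr), s, hs, add_assoc _ _ _⟩⟩
  simpa only [Prod.fst_add, Prod.snd_add, add_sub_assoc] using liq_nonneg_add M ht.le hp hqu

theorem exists_add_selection : ∃ pick : Set (ℝ × ℝ) → Set (ℝ × ℝ) → ℝ × ℝ → ℝ × ℝ,
    ∀ A B p, p ∈ A + B → pick A B p ∈ B ∧ p - pick A B p ∈ A := by
  have h : ∀ (A B : Set (ℝ × ℝ)) (p : ℝ × ℝ), ∃ q, p ∈ A + B → q ∈ B ∧ p - q ∈ A := by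
    intro A B p
    by_cases hp : p ∈ A + B
    · obtain ⟨a, ha, b, hb, rfl⟩ := Set.mem_add.1 hp
      exact ⟨b, fun _ => ⟨hb, by simpa using ha⟩⟩
    · exact ⟨p, fun h => absurd h hp⟩
  choose pick hpick using h
  exact ⟨pick, hpick⟩

/-- Every position in all initial epigraphs of the pricing recursion starts a seller
superhedging strategy. -/
theorem SellerRec.exists_sellerHedge {M : Market Ω} {ξ ζ : ℕ → Ω → ℝ} {z : ℕ → Ω → ℝ → ℝ}
    (hz : SellerRec M ξ ζ z) {p : ℝ × ℝ} (hp : ∀ ω, p ∈ epi (z 0 ω)) :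
    ∃ α β, SellerHedge M ξ ζ α β ∧ ∀ ω, α 0 ω = p.1 ∧ β 0 ω = p.2 := by
  obtain ⟨pick, hpick⟩ := exists_add_selection
  let A : ℕ → Ω → Set (ℝ × ℝ) := fun t ω => epi (hfun (M.Sb t ω) (M.Sa t ω))
  let B : ℕ → Ω → Set (ℝ × ℝ) := fun t ω =>
    ⋂ ω' ∈ {ω'' | sameAtom (M.F t) ω ω''}, epi (z (t + 1) ω')
  let X : ℕ → Ω → ℝ × ℝ := fun t ω =>
    Nat.rec p (fun s x => pick (A s ω) (B s ω) x) t
  have hX : ∀ t ω, X (t + 1) ω = pick (A t ω) (B t ω) (X t ω) := fun _ _ => rfl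
  have hstep : ∀ t ω, t < M.T → X t ω ∈ epi (z t ω) →
      X (t + 1) ω ∈ B t ω ∧ X t ω - X (t + 1) ω ∈ A t ω := by
    intro t ω ht h
    rw [hz.2.2 t ω ht] at h
    exact hpick _ _ _ h.2
  have hmem : ∀ t, t ≤ M.T → ∀ ω, X t ω ∈ epi (z t ω) := by
    intro t
    induction t with
    | zero => exact fun _ => hp
    | succ t ih =>
      intro ht ω
      exact Set.mem_iInter₂.1 (hstep t ω ht (ih (Nat.le_of_succ_le ht) ω)).1 ω fun _ _ => Iff.rfl
  have hconst : ∀ t, t < M.T → ∀ ω ω', sameAtom (M.F t) ω ω' → X (t + 1) ω = X (t + 1) ω' := by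
    have hnext : ∀ t, t < M.T → ∀ ω ω', sameAtom (M.F t) ω ω' → X t ω = X t ω' →
        X (t + 1) ω = X (t + 1) ω' := by
      intro t ht ω ω' h hXt
      have hA : A t ω = A t ω' := by
        simp only [A, h.eq_of_measurable (M.Sb_adapted t ht.le),
          h.eq_of_measurable (M.Sa_adapted t ht.le)]
      have hB : B t ω = B t ω' := by simp only [B, h.setOf_eq]
      rw [hX, hX, hA, hB, hXt]
    intro t
    induction t with
    | zero => exact fun ht ω ω' h => hnext 0 ht ω ω' h rfl
    | succ t ih =>
      exact fun ht ω ω' h => hnext (t + 1) ht ω ω' h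
        (ih (Nat.lt_of_succ_lt ht) ω ω' (h.mono (M.F_mono t.le_succ)))
  refine ⟨fun t ω => (X t ω).1, fun t ω => (X t ω).2,
    ⟨⟨measurable_of_const_on_atoms fun _ _ _ => rfl, measurable_of_const_on_atoms fun _ _ _ => rfl,
      fun t ht => ⟨measurable_of_const_on_atoms fun ω ω' h => congrArg Prod.fst (hconst t ht ω ω' h),
        measurable_of_const_on_atoms fun ω ω' h => congrArg Prod.snd (hconst t ht ω ω' h)⟩,
      fun t ht ω => ?_⟩, fun τ hτ ω => ?_⟩, fun _ => ⟨rfl, rfl⟩⟩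
  · exact (mem_epi_hfun_iff M t ω _).1 (hstep t ω ht (hmem t ht.le ω)).2
  · refine (mem_epi_uSell_iff M ξ ζ (τ ω) ω (X (τ ω) ω)).1 ?_
    have h := hmem (τ ω) (hτ.1 ω) ω
    rcases (hτ.1 ω).lt_or_eq with ht | ht
    · rw [hz.2.2 _ ω ht] at h
      exact h.1
    · rw [ht] at h ⊢
      rwa [hz.2.1 ω] at h

/-- Theorem: in an arbitrage-free model the seller's price equals z₀(0), where z
is produced by the seller's pricing recursion. -/
theorem seller_price_eq_z_zero (ξ ζ : ℕ → Ω → ℝ)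
    (hpay : AdaptedPair M ξ ζ) (hNA : ArbitrageFree M)
    (z : ℕ → Ω → ℝ → ℝ) (hz : SellerRec M ξ ζ z) :
    ∀ ω, askPrice M ξ ζ = z 0 ω 0 := by
  intro ω
  have hatom : ∀ ω', sameAtom (M.F 0) ω ω' := by
    intro ω' A hA
    rw [M.F_zero, MeasurableSpace.measurableSet_bot_iff] at hA
    rcases hA with rfl | rfl <;> simp
  refine IsLeast.csInf_eq ⟨?_, ?_⟩
  · obtain ⟨α, β, h, h0⟩ := hz.exists_sellerHedge (p := (z 0 ω 0, 0)) fun ω' => by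
      rw [← hz.1 0 ω ω' M.T.zero_le (hatom ω')]
      exact le_refl (z 0 ω 0)
    exact ⟨α, β, h, fun ω' => by simp [liq, h0 ω']⟩
  · rintro x ⟨α, β, h, hx⟩
    have hsolv : 0 ≤ liq M 0 ω (x - α 0 ω) (-β 0 ω) := by
      have hxω := hx ω
      unfold liq at hxω ⊢
      linarith
    have hmem := hz.add_mem_epi M.T_pos (p := (x - α 0 ω, -β 0 ω)) hsolv
      (h.mem_epi hz M.T.zero_le ω)
    simpa [epi] using hmem

end RZ
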